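/- arXiv:2405.02203 — 2 statements merged into one kernel-verified Lean document; each statement's English description precedes it below -/
import Mathlib

section
/- The germ G is maximal: if (u_l,u_r) ∈ ℝ² satisfies f_l(u_l) = f_r(u_r) and Φ_l(u_l,k_l) − Φ_r(u_r,k_r) ≥ 0 for every (k_l,k_r) ∈ G, then (u_l,u_r) ∈ G. -/
open Real Set

noncomputable section

/-- `f` is an increasing C¹-diffeomorphism of ℝ onto itself. -/
def IsIncrC1Diffeo (f : ℝ → ℝ) : Prop :=
  StrictMono f ∧ Function.Bijective f ∧ ContDiff ℝ 1 f ∧ ContDiff ℝ 1 (Function.invFun f)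

/-- `f ∈ C¹(ℝ,ℝ)`, `f'` is an increasing C¹-diffeomorphism of ℝ onto itself, and `α` is
the (unique) critical point, i.e. the unique minimizer, of the strictly convex function `f`. -/
def ConvexFlux (f : ℝ → ℝ) (α : ℝ) : Prop :=
  ContDiff ℝ 1 f ∧ IsIncrC1Diffeo (deriv f) ∧ deriv f α = 0

/-- The germ `G = G₁ ∪ G₂ ∪ G₃`.  A point `k_r` with `f_r k_r = y` and `k_r ≥ α_r`
(resp. `k_r ≤ α_r`) is exactly `S_r⁺ y` (resp. `S_r⁻ y`). -/
def germ (fl fr : ℝ → ℝ) (αl αr : ℝ) : Set (ℝ × ℝ) :=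
  {p | (αl ≤ p.1 ∧ αr ≤ p.2 ∧ fr p.2 = fl p.1) ∨
       (p.1 ≤ αl ∧ p.2 ≤ αr ∧ fr p.2 = fl p.1) ∨
       (αl < p.1 ∧ p.2 ≤ αr ∧ fr p.2 = fl p.1)}

/-- Kruzhkov entropy flux associated with `f`. -/
def PhiK (f : ℝ → ℝ) (a b : ℝ) : ℝ := Real.sign (a - b) * (f a - f b)

theorem ConvexFlux.strictAntiOn {f : ℝ → ℝ} {α : ℝ} (h : ConvexFlux f α) :
    StrictAntiOn f (Iic α) := by
  refine strictAntiOn_of_deriv_neg (convex_Iic α) h.1.continuous.continuousOn fun x hx => ?_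
  rw [interior_Iic] at hx
  exact h.2.2 ▸ h.2.1.1 hx

theorem ConvexFlux.strictMonoOn {f : ℝ → ℝ} {α : ℝ} (h : ConvexFlux f α) :
    StrictMonoOn f (Ici α) := by
  refine strictMonoOn_of_deriv_pos (convex_Ici α) h.1.continuous.continuousOn fun x hx => ?_
  rw [interior_Ici] at hx
  exact h.2.2 ▸ h.2.1.1 hx

/-- A state pair with converging characteristics is not dissipative against a connected pair
lying strictly between its two states at a strictly lower flux level. -/
theorem PhiK_sub_PhiK_neg {f g : ℝ → ℝ} {a b k m : ℝ} (hab : f a = g b) (hkm : g m = f k)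
    (hak : a < k) (hmb : m < b) (hk : f k < f a) : PhiK f a k - PhiK g b m < 0 := by
  rw [PhiK, PhiK, Real.sign_of_neg (sub_neg.2 hak), Real.sign_of_pos (sub_pos.2 hmb)]
  linarith

/-- Maximality of the germ `G`: any pair satisfying the Rankine–Hugoniot condition and
dissipative against every element of `G` belongs to `G`. -/
theorem germ_is_maximal (fl fr : ℝ → ℝ) (αl αr : ℝ)
    (hfl : ConvexFlux fl αl) (hfr : ConvexFlux fr αr)
    (ul ur : ℝ) (hRH : fl ul = fr ur)
    (hdiss : ∀ k ∈ germ fl fr αl αr, PhiK fl ul k.1 - PhiK fr ur k.2 ≥ 0) :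
    (ul, ur) ∈ germ fl fr αl αr := by
  by_contra hG
  have hu : ul < αl ∧ αr < ur := by
    simp only [germ, mem_ofPred_eq] at hG
    grind
  obtain ⟨hul, hur⟩ := hu
  have hl : fl αl < fl ul := hfl.strictAntiOn hul.le self_mem_Iic hul
  have hr : fr αr < fr ur := hfr.strictMonoOn self_mem_Ici hur.le hur
  obtain ⟨kl, kr, hk, hukl, hkru, hlt⟩ : ∃ kl kr, (kl, kr) ∈ germ fl fr αl αr ∧
      ul < kl ∧ kr < ur ∧ fl kl < fl ul := by
    rcases le_total (fr αr) (fl αl) with h | h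
    · obtain ⟨kr, ⟨h1, h2⟩, h3⟩ := intermediate_value_Ico hur.le
        hfr.1.continuous.continuousOn ⟨h, hRH ▸ hl⟩
      exact ⟨αl, kr, Or.inl ⟨le_rfl, h1, h3⟩, hul, h2, hl⟩
    · obtain ⟨kl, ⟨h1, h2⟩, h3⟩ := intermediate_value_Ioc' hul.le
        hfl.1.continuous.continuousOn ⟨h, hRH ▸ hr⟩
      exact ⟨kl, αr, Or.inr (Or.inl ⟨h2, le_rfl, h3.symm⟩), h1, hur, by rw [h3, hRH]; exact hr⟩
  have hkk : fr kr = fl kl := by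
    rcases hk with h | h | h <;> exact h.2.2
  exact (PhiK_sub_PhiK_neg hRH hkk hukl hkru hlt).not_ge (hdiss _ hk)
end
end

section
/- For every k ∈ ℝ: if α_r ≤ k < α_l then R(k,k) = |max{min f_l, min f_r} − f_l(k)| + |max{min f_l, min f_r} − f_r(k)|, and otherwise R(k,k) = |f_l(k) − f_r(k)|. -/
open Real Set

noncomputable section

/-- The interface flux `F_int(u_l,u_r) = max{f_l(u_l ∨ α_l), f_r(α_r ∧ u_r)}`. -/
def Fint (fl fr : ℝ → ℝ) (αl αr : ℝ) (ul ur : ℝ) : ℝ :=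
  max (fl (max ul αl)) (fr (min αr ur))

/-- The remainder term `R(u_l,u_r)`. -/
def Rem (fl fr : ℝ → ℝ) (αl αr : ℝ) (ul ur : ℝ) : ℝ :=
  |Fint fl fr αl αr ul ur - fl ul| + |Fint fl fr αl αr ul ur - fr ur|

/-- A flux in the sense of `ConvexFlux` attains its minimum at its critical point. -/
theorem ConvexFlux.apply_le {f : ℝ → ℝ} {α : ℝ} (h : ConvexFlux f α) (x : ℝ) : f α ≤ f x := by
  obtain ⟨hf, ⟨hmono, -⟩, hα⟩ := h
  have hd : Differentiable ℝ f := hf.differentiable one_ne_zero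
  rcases le_total α x with hx | hx
  · refine monotoneOn_of_deriv_nonneg (convex_Ici α) hd.continuous.continuousOn
      hd.differentiableOn (fun y hy => ?_) self_mem_Ici hx hx
    rw [interior_Ici] at hy
    exact hα ▸ hmono.monotone (le_of_lt hy)
  · refine antitoneOn_of_deriv_nonpos (convex_Iic α) hd.continuous.continuousOn
      hd.differentiableOn (fun y hy => ?_) hx self_mem_Iic hx
    rw [interior_Iic] at hy
    exact hα ▸ hmono.monotone (le_of_lt hy)

/-- The distances from `m` to `x` and `y` add up to `|x - y|` when `m` lies between them. -/
theorem abs_sub_add_abs_sub_of_mem_uIcc {m x y : ℝ} (h : m ∈ uIcc x y) :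
    |m - x| + |m - y| = |x - y| := by
  rcases mem_uIcc.1 h with ⟨h₁, h₂⟩ | ⟨h₁, h₂⟩
  · rw [abs_of_nonneg (by linarith), abs_of_nonpos (by linarith), abs_of_nonpos (by linarith)]
    ring
  · rw [abs_of_nonpos (by linarith), abs_of_nonneg (by linarith), abs_of_nonneg (by linarith)]
    ring

/-- Value of the remainder term on constant pairs `(k,k)`; here `min f_l = f_l α_l` and
`min f_r = f_r α_r` since `α_l, α_r` are the minimizers. -/
theorem rem_const (fl fr : ℝ → ℝ) (αl αr : ℝ)
    (hfl : ConvexFlux fl αl) (hfr : ConvexFlux fr αr) (k : ℝ) :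
    (αr ≤ k ∧ k < αl →
      Rem fl fr αl αr k k =
        |max (fl αl) (fr αr) - fl k| + |max (fl αl) (fr αr) - fr k|) ∧
    (¬(αr ≤ k ∧ k < αl) → Rem fl fr αl αr k k = |fl k - fr k|) := by
  refine ⟨fun ⟨hr, hl⟩ => ?_, fun h => ?_⟩
  · simp only [Rem, Fint, max_eq_right hl.le, min_eq_left hr]
  have hminl := hfl.apply_le k
  have hminr := hfr.apply_le k
  refine abs_sub_add_abs_sub_of_mem_uIcc ?_
  rw [mem_uIcc, Fint]
  rcases le_or_gt αr k with hr | hr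
  · have hl : αl ≤ k := not_lt.1 fun hl => h ⟨hr, hl⟩
    rw [max_eq_left hl, min_eq_left hr]
    grind
  · rw [min_eq_right hr.le]
    rcases le_total αl k with hl | hl
    · rw [max_eq_left hl]
      grind
    · rw [max_eq_right hl]
      grind
end
end
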